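/- Let (X, d) be a compact metric space. Then the set {α ∈ Homeo(X) : mdim(α) = 0} is a G_δ subset of Homeo(X) with respect to the metric ρ; explicitly, it equals the countable intersection over k ≥ 1 and over finite open covers 𝒰 by members of a fixed countable base of the sets {α ∈ Homeo(X) : inf_{n≥1} 𝒟(𝒰, α, n)/n < 1/k}, each of which is open. -/

import Mathlib

/-- The metric `ρ(g,h) = sup_x d(g x, h x) + sup_x d(g⁻¹ x, h⁻¹ x)` on `Homeo(X)`. -/
noncomputable def homeoDist {X : Type*} [MetricSpace X] (g h : X ≃ₜ X) : ℝ :=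
  (⨆ x : X, dist (g x) (h x)) + (⨆ x : X, dist (g.symm x) (h.symm x))

-- The order of a finite cover: `ord(𝒰) = max_x Σ_{U ∈ 𝒰} χ_U(x) − 1`.
open Classical in
noncomputable def coverOrd {X : Type*} (U : Finset (Set X)) : ℕ :=
  ⨆ x : X, ((U.filter fun u => x ∈ u).card - 1)

/-- `𝒟(𝒰)`: the minimal order of a finite open cover refining `𝒰`. -/
noncomputable def coverD {X : Type*} [TopologicalSpace X] (U : Set (Set X)) : ℕ :=
  sInf {m : ℕ | ∃ V : Finset (Set X), (∀ v ∈ V, IsOpen v) ∧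
    ⋃₀ (V : Set (Set X)) = Set.univ ∧ (∀ v ∈ V, ∃ u ∈ U, v ⊆ u) ∧ coverOrd V = m}

/-- The join `𝒰 ∨ α⁻¹(𝒰) ∨ ⋯ ∨ α^{-n+1}(𝒰)`: its members are the sets
`⋂_{r=0}^{n-1} α^{-r}(U_r)` with each `U_r ∈ 𝒰`. -/
def joinCover {X : Type*} [TopologicalSpace X] (U : Set (Set X)) (α : X ≃ₜ X) (n : ℕ) :
    Set (Set X) :=
  {V : Set X | ∃ f : Fin n → Set X, (∀ r, f r ∈ U) ∧
    V = ⋂ r : Fin n, ⇑(α.toEquiv ^ (r : ℕ)) ⁻¹' f r}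

/-- `𝒟(𝒰, α, n) = 𝒟(𝒰 ∨ α⁻¹(𝒰) ∨ ⋯ ∨ α^{-n+1}(𝒰))`. -/
noncomputable def coverDn {X : Type*} [TopologicalSpace X] (U : Set (Set X)) (α : X ≃ₜ X)
    (n : ℕ) : ℕ :=
  coverD (joinCover U α n)

/-- The mean dimension `mdim(α) = sup_𝒰 inf_{n ≥ 1} 𝒟(𝒰, α, n)/n`, the supremum over all
finite open covers `𝒰` of `X`. -/
noncomputable def mdim {X : Type*} [TopologicalSpace X] (α : X ≃ₜ X) : ENNReal :=
  ⨆ U ∈ {U : Finset (Set X) | (∀ u ∈ U, IsOpen u) ∧ ⋃₀ (U : Set (Set X)) = Set.univ},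
    ⨅ n : ℕ, (coverDn (↑U) α (n + 1) : ENNReal) / ((n : ENNReal) + 1)

open Filter Topology

section Covers

variable {X : Type*}

/-- A family of open sets covering a compact space has a finite subcover. -/
theorem exists_finset_subcover [TopologicalSpace X] [CompactSpace X] {S : Set (Set X)}
    (hS : ∀ s ∈ S, IsOpen s) (hcov : ⋃₀ S = Set.univ) :
    ∃ T : Finset (Set X), (T : Set (Set X)) ⊆ S ∧ ⋃₀ (T : Set (Set X)) = Set.univ := by
  obtain ⟨T, hTS, hTfin, hT⟩ := isCompact_univ.elim_finite_subcover_image (c := id) hS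
    (by rw [← hcov, Set.sUnion_eq_biUnion]; rfl)
  lift T to Finset (Set X) using hTfin
  exact ⟨T, hTS, Set.univ_subset_iff.1 (by rwa [Set.sUnion_eq_biUnion])⟩

open Classical in
theorem bddAbove_range_card_filter_mem (V : Finset (Set X)) :
    BddAbove (Set.range fun x : X => (V.filter fun u => x ∈ u).card - 1) := by
  refine ⟨V.card, ?_⟩
  rintro _ ⟨x, rfl⟩
  exact (Nat.sub_le _ _).trans (Finset.card_filter_le _ _)

open Classical in
/-- Shrinking the members of a cover does not increase its order. -/
theorem coverOrd_image_le (V : Finset (Set X)) (w : Set X → Set X) (hw : ∀ v ∈ V, w v ⊆ v) :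
    coverOrd (V.image w) ≤ coverOrd V := by
  rcases isEmpty_or_nonempty X with hX | hX
  · simp [coverOrd]
  refine ciSup_le fun x => le_trans ?_ (le_ciSup (bddAbove_range_card_filter_mem V) x)
  refine Nat.sub_le_sub_right ?_ 1
  rw [Finset.filter_image]
  refine Finset.card_image_le.trans (Finset.card_le_card fun v hv => ?_)
  rw [Finset.mem_filter] at hv ⊢
  exact ⟨hv.1, hw v hv.1 hv.2⟩

variable [TopologicalSpace X]

theorem coverD_le {U : Set (Set X)} {V : Finset (Set X)} (hV : ∀ v ∈ V, IsOpen v)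
    (hcov : ⋃₀ (V : Set (Set X)) = Set.univ) (href : ∀ v ∈ V, ∃ u ∈ U, v ⊆ u) :
    coverD U ≤ coverOrd V :=
  Nat.sInf_le ⟨V, hV, hcov, href, rfl⟩

theorem exists_coverOrd_eq_coverD [CompactSpace X] {U : Set (Set X)}
    (hU : ∀ u ∈ U, IsOpen u) (hcov : ⋃₀ U = Set.univ) :
    ∃ V : Finset (Set X), (∀ v ∈ V, IsOpen v) ∧ ⋃₀ (V : Set (Set X)) = Set.univ ∧
      (∀ v ∈ V, ∃ u ∈ U, v ⊆ u) ∧ coverOrd V = coverD U := by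
  obtain ⟨T, hTU, hT⟩ := exists_finset_subcover hU hcov
  exact Nat.sInf_mem (s := {m : ℕ | ∃ V : Finset (Set X), (∀ v ∈ V, IsOpen v) ∧
    ⋃₀ (V : Set (Set X)) = Set.univ ∧ (∀ v ∈ V, ∃ u ∈ U, v ⊆ u) ∧ coverOrd V = m})
    ⟨_, T, fun v hv => hU v (hTU hv), hT, fun v hv => ⟨v, hTU hv, subset_rfl⟩, rfl⟩

/-- `𝒟` is monotone under refinement. -/
theorem coverD_le_coverD_of_refines [CompactSpace X] {U W : Set (Set X)}
    (hW : ∀ w ∈ W, IsOpen w) (hcov : ⋃₀ W = Set.univ) (href : ∀ w ∈ W, ∃ u ∈ U, w ⊆ u) :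
    coverD U ≤ coverD W := by
  obtain ⟨V, hV, hVcov, hVW, hVord⟩ := exists_coverOrd_eq_coverD hW hcov
  rw [← hVord]
  refine coverD_le hV hVcov fun v hv => ?_
  obtain ⟨w, hw, hvw⟩ := hVW v hv
  obtain ⟨u, hu, hwu⟩ := href w hw
  exact ⟨u, hu, hvw.trans hwu⟩

theorem continuous_toEquiv_pow (α : X ≃ₜ X) (r : ℕ) : Continuous ⇑(α.toEquiv ^ r) := by
  rw [Equiv.Perm.coe_pow]
  exact α.continuous.iterate r

theorem isOpen_of_mem_joinCover {U : Set (Set X)} (hU : ∀ u ∈ U, IsOpen u) (α : X ≃ₜ X) (n : ℕ) :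
    ∀ v ∈ joinCover U α n, IsOpen v := by
  rintro _ ⟨f, hf, rfl⟩
  exact isOpen_iInter_of_finite fun r => (hU _ (hf r)).preimage (continuous_toEquiv_pow α r)

theorem sUnion_joinCover {U : Set (Set X)} (hcov : ⋃₀ U = Set.univ) (α : X ≃ₜ X) (n : ℕ) :
    ⋃₀ joinCover U α n = Set.univ := by
  refine Set.eq_univ_of_forall fun x => ?_
  choose g hgU hg using fun y : X => Set.mem_sUnion.1 (hcov.ge (Set.mem_univ y))
  exact ⟨_, ⟨fun r => g ((α.toEquiv ^ (r : ℕ)) x), fun r => hgU _, rfl⟩,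
    Set.mem_iInter.2 fun r => hg _⟩

theorem joinCover_refines {U W : Set (Set X)} (href : ∀ w ∈ W, ∃ u ∈ U, w ⊆ u) (α : X ≃ₜ X)
    (n : ℕ) : ∀ w ∈ joinCover W α n, ∃ u ∈ joinCover U α n, w ⊆ u := by
  rintro _ ⟨f, hf, rfl⟩
  choose g hgU hg using fun r => href (f r) (hf r)
  exact ⟨_, ⟨g, hgU, rfl⟩, Set.iInter_mono fun r => Set.preimage_mono (hg r)⟩

theorem coverDn_le_coverDn_of_refines [CompactSpace X] {U W : Set (Set X)}
    (hW : ∀ w ∈ W, IsOpen w) (hcov : ⋃₀ W = Set.univ) (href : ∀ w ∈ W, ∃ u ∈ U, w ⊆ u)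
    (α : X ≃ₜ X) (n : ℕ) : coverDn U α n ≤ coverDn W α n :=
  coverD_le_coverD_of_refines (isOpen_of_mem_joinCover hW α n) (sUnion_joinCover hcov α n)
    (joinCover_refines href α n)

/-- In a normal space a finite open cover can be shrunk so that the closures of the new members
lie in the old ones. -/
theorem exists_shrinking_finset [NormalSpace X] {V : Finset (Set X)} (hV : ∀ v ∈ V, IsOpen v)
    (hcov : ⋃₀ (V : Set (Set X)) = Set.univ) :
    ∃ w : Set X → Set X, (∀ v ∈ V, IsOpen (w v)) ∧ (∀ v ∈ V, closure (w v) ⊆ v) ∧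
      ⋃ v ∈ V, w v = Set.univ := by
  obtain ⟨w, hwcov, hwo, hwc⟩ := exists_iUnion_eq_closure_subset
    (u := fun v : V => (v : Set X)) (fun v => hV v v.2) (fun x => Set.toFinite _)
    (by rw [← hcov, Set.sUnion_eq_iUnion]; rfl)
  classical
  refine ⟨fun v => if hv : v ∈ V then w ⟨v, hv⟩ else ∅, fun v hv => ?_, fun v hv => ?_, ?_⟩
  · simpa [hv] using hwo ⟨v, hv⟩
  · simpa [hv] using hwc ⟨v, hv⟩
  · refine Set.eq_univ_of_forall fun x => ?_
    obtain ⟨v, hv⟩ := Set.mem_iUnion.1 (hwcov.ge (Set.mem_univ x))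
    exact Set.mem_iUnion₂.2 ⟨v, v.2, by simpa using hv⟩

end Covers

section Perturbation

variable {X : Type*} [MetricSpace X]

theorem homeoDist_nonneg (g h : X ≃ₜ X) : 0 ≤ homeoDist g h :=
  add_nonneg (Real.iSup_nonneg fun _ => dist_nonneg) (Real.iSup_nonneg fun _ => dist_nonneg)

variable [CompactSpace X]

theorem dist_le_homeoDist (g h : X ≃ₜ X) (x : X) : dist (g x) (h x) ≤ homeoDist g h := by
  have hbdd : BddAbove (Set.range fun x : X => dist (g x) (h x)) :=
    (isCompact_range (g.continuous.dist h.continuous)).bddAbove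
  exact (le_ciSup hbdd x).trans
    (le_add_of_nonneg_right (Real.iSup_nonneg fun _ => dist_nonneg))

/-- Iterates depend uniformly on the homeomorphism. -/
theorem tendstoUniformly_toEquiv_pow (α : X ≃ₜ X) (r : ℕ) :
    TendstoUniformly (fun (β : X ≃ₜ X) => ⇑(β.toEquiv ^ r)) ⇑(α.toEquiv ^ r)
      (comap (homeoDist α) (𝓝 0)) := by
  induction r with
  | zero =>
    rw [Metric.tendstoUniformly_iff]
    intro ε hε
    simp [hε]
  | succ r ih =>
    rw [Metric.tendstoUniformly_iff] at ih ⊢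
    intro ε hε
    obtain ⟨δ, hδ, hα⟩ := Metric.uniformContinuous_iff.1
      (CompactSpace.uniformContinuous_of_continuous (continuous_toEquiv_pow α r)) (ε / 2)
      (half_pos hε)
    have hclose : ∀ᶠ β in comap (homeoDist α) (𝓝 0), homeoDist α β < δ :=
      tendsto_comap.eventually (gt_mem_nhds hδ)
    filter_upwards [ih (ε / 2) (half_pos hε), hclose] with β hβ hαβ x
    rw [pow_succ, pow_succ, Equiv.Perm.mul_apply, Equiv.Perm.mul_apply]
    calc _ ≤ dist ((α.toEquiv ^ r) (α x)) ((α.toEquiv ^ r) (β x)) +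
          dist ((α.toEquiv ^ r) (β x)) ((β.toEquiv ^ r) (β x)) := dist_triangle _ _ _
      _ < ε / 2 + ε / 2 := add_lt_add (hα ((dist_le_homeoDist α β x).trans_lt hαβ)) (hβ _)
      _ = ε := add_halves ε

theorem eventually_subset_preimage_toEquiv_pow (α : X ≃ₜ X) (r : ℕ) {K u : Set X}
    (hK : IsCompact K) (hu : IsOpen u) (hKu : K ⊆ ⇑(α.toEquiv ^ r) ⁻¹' u) :
    ∀ᶠ β : X ≃ₜ X in comap (homeoDist α) (𝓝 0), K ⊆ ⇑(β.toEquiv ^ r) ⁻¹' u := by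
  obtain ⟨ε, hε, hεu⟩ := (hK.image (continuous_toEquiv_pow α r)).exists_thickening_subset_open hu
    (Set.image_subset_iff.2 hKu)
  filter_upwards [Metric.tendstoUniformly_iff.1 (tendstoUniformly_toEquiv_pow α r) ε hε]
    with β hβ x hx
  exact hεu (Metric.mem_thickening_iff.2
    ⟨_, Set.mem_image_of_mem _ hx, (dist_comm _ _).trans_lt (hβ x)⟩)

/-- `α ↦ 𝒟(𝒰, α, n)` is upper semicontinuous. -/
theorem eventually_coverDn_le {U : Set (Set X)} (hU : ∀ u ∈ U, IsOpen u)
    (hcov : ⋃₀ U = Set.univ) (α : X ≃ₜ X) (n : ℕ) :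
    ∀ᶠ β in comap (homeoDist α) (𝓝 0), coverDn U β n ≤ coverDn U α n := by
  classical
  obtain ⟨V, hV, hVcov, hVref, hVord⟩ := exists_coverOrd_eq_coverD
    (isOpen_of_mem_joinCover hU α n) (sUnion_joinCover hcov α n)
  obtain ⟨w, hwo, hwc, hwcov⟩ := exists_shrinking_finset hV hVcov
  have hsub : ∀ᶠ β in comap (homeoDist α) (𝓝 0), ∀ v ∈ V, ∃ u ∈ joinCover U β n, w v ⊆ u := by
    rw [Filter.eventually_all_finset]
    intro v hv
    obtain ⟨_, ⟨f, hf, rfl⟩, hvf⟩ := hVref v hv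
    have hev : ∀ᶠ β : X ≃ₜ X in comap (homeoDist α) (𝓝 0), ∀ r : Fin n,
        closure (w v) ⊆ ⇑(β.toEquiv ^ (r : ℕ)) ⁻¹' f r :=
      Filter.eventually_all.2 fun r => eventually_subset_preimage_toEquiv_pow α r
        isClosed_closure.isCompact (hU _ (hf r))
        (((hwc v hv).trans hvf).trans (Set.iInter_subset _ r))
    filter_upwards [hev] with β hβ
    exact ⟨_, ⟨f, hf, rfl⟩, subset_closure.trans (Set.subset_iInter hβ)⟩
  filter_upwards [hsub] with β hβ
  calc coverDn U β n ≤ coverOrd (V.image w) :=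
        coverD_le (by simpa using hwo) (by simpa using hwcov) (by simpa using hβ)
    _ ≤ coverOrd V := coverOrd_image_le V w fun v hv => subset_closure.trans (hwc v hv)
    _ = coverDn U α n := hVord

end Perturbation

section Averages

theorem ciInf_div_lt_iff (a : ℕ → ℕ) (c : ℝ) :
    (⨅ n : ℕ, (a n : ℝ) / ((n : ℝ) + 1)) < c ↔ ∃ n : ℕ, (a n : ℝ) / ((n : ℝ) + 1) < c :=
  ciInf_lt_iff ⟨0, by rintro _ ⟨n, rfl⟩; positivity⟩

theorem ennreal_natCast_div_lt_iff (a n k : ℕ) :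
    (a : ENNReal) / ((n : ENNReal) + 1) < ((k : ENNReal) + 1)⁻¹ ↔
      (a : ℝ) / ((n : ℝ) + 1) < 1 / ((k : ℝ) + 1) := by
  have hl : (a : ENNReal) / ((n : ENNReal) + 1) = ENNReal.ofReal ((a : ℝ) / ((n : ℝ) + 1)) := by
    rw [ENNReal.ofReal_div_of_pos (by positivity), ENNReal.ofReal_add (by positivity) zero_le_one]
    simp
  have hr : ((k : ENNReal) + 1)⁻¹ = ENNReal.ofReal (1 / ((k : ℝ) + 1)) := by
    rw [ENNReal.ofReal_div_of_pos (by positivity), ENNReal.ofReal_add (by positivity) zero_le_one]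
    simp
  rw [hl, hr, ENNReal.ofReal_lt_ofReal_iff (by positivity)]

theorem iInf_natCast_div_eq_zero_iff (a : ℕ → ℕ) :
    (⨅ n : ℕ, (a n : ENNReal) / ((n : ENNReal) + 1)) = 0 ↔
      ∀ k : ℕ, ∃ n : ℕ, (a n : ℝ) / ((n : ℝ) + 1) < 1 / ((k : ℝ) + 1) := by
  simp_rw [← ennreal_natCast_div_lt_iff]
  refine ⟨fun h k => iInf_lt_iff.1 (h ▸ ENNReal.inv_pos.2 (by finiteness)), fun h => ?_⟩
  by_contra hne
  obtain ⟨k, hk⟩ := ENNReal.exists_inv_nat_lt hne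
  obtain ⟨n, hn⟩ := h k
  have hle : ((k : ENNReal) + 1)⁻¹ ≤ (k : ENNReal)⁻¹ := ENNReal.inv_le_inv.2 le_self_add
  exact absurd (iInf_le _ n) (not_le.2 ((hn.trans_le hle).trans hk))

end Averages

theorem mdim_eq_zero_iff {X : Type*} [TopologicalSpace X] (α : X ≃ₜ X) :
    mdim α = 0 ↔ ∀ U : Finset (Set X), (∀ u ∈ U, IsOpen u) →
      ⋃₀ (U : Set (Set X)) = Set.univ →
      ∀ k : ℕ, ∃ n : ℕ, (coverDn (↑U) α (n + 1) : ℝ) / ((n : ℝ) + 1) < 1 / ((k : ℝ) + 1) := by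
  simp_rw [← iInf_natCast_div_eq_zero_iff (fun n => coverDn _ α (n + 1))]
  simp [mdim]


/-- Let `(X, d)` be a compact metric space.  Then
`{α ∈ Homeo(X) : mdim(α) = 0}` is a `G_δ` subset of `Homeo(X)` with respect to the metric
`ρ`: it equals the countable intersection, over `k` and over finite open covers `𝒰` by
members of a fixed countable base `ℬ`, of the sets
`{α : inf_{n ≥ 1} 𝒟(𝒰, α, n)/n < 1/k}`, each of which is open. -/
theorem mdim_zero_Gdelta {X : Type*} [MetricSpace X] [CompactSpace X]
    (B : Set (Set X)) (hBc : B.Countable) (hB : TopologicalSpace.IsTopologicalBasis B) :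
    (∀ (k : ℕ) (U : Finset (Set X)), (↑U : Set (Set X)) ⊆ B → (∀ u ∈ U, IsOpen u) →
      ⋃₀ (U : Set (Set X)) = Set.univ →
      ∀ α : X ≃ₜ X,
        (⨅ n : ℕ, (coverDn (↑U) α (n + 1) : ℝ) / ((n : ℝ) + 1)) < 1 / ((k : ℝ) + 1) →
        ∃ δ > 0, ∀ β : X ≃ₜ X, homeoDist α β < δ →
          (⨅ n : ℕ, (coverDn (↑U) β (n + 1) : ℝ) / ((n : ℝ) + 1)) < 1 / ((k : ℝ) + 1)) ∧
    {α : X ≃ₜ X | mdim α = 0} =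
      ⋂ (k : ℕ), ⋂ (U : Finset (Set X)),
        ⋂ (_ : (↑U : Set (Set X)) ⊆ B ∧ (∀ u ∈ U, IsOpen u) ∧
            ⋃₀ (U : Set (Set X)) = Set.univ),
          {α : X ≃ₜ X |
            (⨅ n : ℕ, (coverDn (↑U) α (n + 1) : ℝ) / ((n : ℝ) + 1)) < 1 / ((k : ℝ) + 1)} := by
  refine ⟨fun k U _ hU hcov α hα => ?_, ?_⟩
  · obtain ⟨n, hn⟩ := (ciInf_div_lt_iff (fun n => coverDn (↑U) α (n + 1)) _).1 hα
    obtain ⟨s, hs, hsub⟩ := mem_comap.1 (eventually_coverDn_le hU hcov α (n + 1))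
    obtain ⟨δ, hδ, hball⟩ := Metric.mem_nhds_iff.1 hs
    refine ⟨δ, hδ, fun β hβ =>
      (ciInf_div_lt_iff (fun n => coverDn (↑U) β (n + 1)) _).2 ⟨n, lt_of_le_of_lt ?_ hn⟩⟩
    have hle : coverDn (↑U) β (n + 1) ≤ coverDn (↑U) α (n + 1) := hsub <| hball <| by
      rwa [Metric.mem_ball, Real.dist_0_eq_abs, abs_of_nonneg (homeoDist_nonneg α β)]
    gcongr
  · ext α
    simp only [Set.mem_ofPred_eq, Set.mem_iInter, mdim_eq_zero_iff]
    refine ⟨fun h k U hU =>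
      (ciInf_div_lt_iff (fun n => coverDn (↑U) α (n + 1)) _).2 (h U hU.2.1 hU.2.2 k),
      fun h U hU hcov k => ?_⟩
    have hS : ⋃₀ {b ∈ B | ∃ u ∈ U, b ⊆ u} = Set.univ := by
      refine Set.eq_univ_of_forall fun x => ?_
      obtain ⟨u, hu, hxu⟩ := hcov.ge (Set.mem_univ x)
      obtain ⟨b, hb, hxb, hbu⟩ := hB.exists_subset_of_mem_open hxu (hU u hu)
      exact ⟨b, ⟨hb, u, hu, hbu⟩, hxb⟩
    obtain ⟨W, hWS, hW⟩ := exists_finset_subcover (fun b hb => hB.isOpen hb.1) hS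
    have hWo : ∀ w ∈ W, IsOpen w := fun w hw => hB.isOpen (hWS hw).1
    obtain ⟨n, hn⟩ := (ciInf_div_lt_iff (fun n => coverDn (↑W) α (n + 1)) _).1
      (h k W ⟨fun w hw => (hWS hw).1, hWo, hW⟩)
    refine ⟨n, lt_of_le_of_lt ?_ hn⟩
    have hle : coverDn (↑U) α (n + 1) ≤ coverDn (↑W) α (n + 1) :=
      coverDn_le_coverDn_of_refines hWo hW (fun w hw => (hWS hw).2) α (n + 1)
    gcongr
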